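/- arXiv:1307.5554 — 2 statements merged into one kernel-verified Lean document; each statement's English description precedes it below -/
import Mathlib

section
/- Let n ≥ 1. The φ(n) functions ℤ/n → ℂ given by m ↦ c(m,χ) = ∑_{a ∈ (ℤ/n)^*} ζ_n^{ma} · conj(χ(a)), one for each multiplicative character χ of ℤ/n, are linearly independent over ℂ. Equivalently, the n×φ(n) matrix (c(m,χ))_{m ∈ ℤ/n, χ} has rank φ(n). -/
/-- The standard primitive `n`-th root of unity `ζ_n = exp(2πi/n)`. -/
noncomputable def zetaN (n : ℕ) : ℂ := Complex.exp (2 * Real.pi * Complex.I / n)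

/-- `c(m,χ) = ∑_{a ∈ (ℤ/n)^*} ζ_n^{m·a} · conj(χ(a))`. -/
noncomputable def cSum (n : ℕ) [NeZero n] (m : ZMod n) (χ : (ZMod n)ˣ →* ℂˣ) : ℂ :=
  ∑ a : (ZMod n)ˣ, zetaN n ^ ((m * (a : ZMod n)).val) * (starRingEnd ℂ) ((χ a : ℂˣ) : ℂ)

/-- The powers of `ζ_n` are the values of the standard additive character of `ℤ/n`. -/
lemma zetaN_pow_val (n : ℕ) [NeZero n] (j : ZMod n) :
    zetaN n ^ j.val = ZMod.stdAddChar j := by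
  rw [ZMod.stdAddChar_apply, ZMod.toCircle_apply, zetaN, ← Complex.exp_nat_mul]
  congr 1
  ring

/-- The additive characters `m ↦ ζ_n^{ma}`, for `a` a unit of `ℤ/n`, are linearly independent. -/
lemma linearIndependent_zetaN_pow (n : ℕ) [NeZero n] :
    LinearIndependent ℂ
      (fun (a : (ZMod n)ˣ) (m : ZMod n) => zetaN n ^ (m * (a : ZMod n)).val) := by
  have inj : Function.Injective
      (fun a : (ZMod n)ˣ => AddChar.mulShift (ZMod.stdAddChar (N := n)) (a : ZMod n)) :=
    (AddChar.to_mulShift_inj_of_isPrimitive (ZMod.isPrimitive_stdAddChar n)).comp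
      Units.val_injective
  have key := (AddChar.linearIndependent (ZMod n) ℂ).comp _ inj
  have eq : (fun (a : (ZMod n)ˣ) (m : ZMod n) => zetaN n ^ (m * (a : ZMod n)).val) =
      (fun χ : AddChar (ZMod n) ℂ => (χ : ZMod n → ℂ)) ∘
        (fun a : (ZMod n)ˣ => AddChar.mulShift (ZMod.stdAddChar (N := n)) (a : ZMod n)) := by
    ext a m
    simp [zetaN_pow_val, AddChar.mulShift_apply, mul_comm]
  rw [eq]
  exact key

/-- The complex conjugates of the multiplicative characters of a monoid are linearly independent. -/
lemma linearIndependent_conj_unitsHom (G : Type*) [Monoid G] :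
    LinearIndependent ℂ
      (fun (χ : G →* ℂˣ) (a : G) => (starRingEnd ℂ) ((χ a : ℂˣ) : ℂ)) := by
  have inj : Function.Injective (fun χ : G →* ℂˣ =>
      ((starRingEnd ℂ : ℂ →+* ℂ) : ℂ →* ℂ).comp ((Units.coeHom ℂ).comp χ)) := by
    intro χ ψ h
    ext a
    exact (starRingEnd ℂ).injective (DFunLike.congr_fun h a)
  have key := (linearIndependent_monoidHom G ℂ).comp _ inj
  exact key

/-- The functions `m ↦ c(m,χ)` on `ℤ/n`, one for each multiplicative character `χ`
of `ℤ/n`, are linearly independent over `ℂ`. -/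
theorem stmt5 (n : ℕ) [NeZero n] :
    LinearIndependent ℂ (fun (χ : (ZMod n)ˣ →* ℂˣ) => (fun m : ZMod n => cSum n m χ)) := by
  have inj := linearIndependent_iff_injective_fintypeLinearCombination.mp (linearIndependent_zetaN_pow n)
  have key := (linearIndependent_conj_unitsHom (ZMod n)ˣ).map' _ (LinearMap.ker_eq_bot.mpr inj)
  have eq : (fun (χ : (ZMod n)ˣ →* ℂˣ) (m : ZMod n) => cSum n m χ) =
      Fintype.linearCombination ℂ
          (fun (a : (ZMod n)ˣ) (m : ZMod n) => zetaN n ^ (m * (a : ZMod n)).val) ∘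
        (fun (χ : (ZMod n)ˣ →* ℂˣ) (a : (ZMod n)ˣ) => (starRingEnd ℂ) ((χ a : ℂˣ) : ℂ)) := by
    ext χ m
    simp [cSum, Fintype.linearCombination_apply, mul_comm]
  rw [eq]
  exact key
end

section
/- Let k ≥ 1, let p be a prime, let n' ≥ 1 with p not dividing n', and set n = p·n'. Let χ' be a multiplicative character of ℤ/n', let q ∈ (ℤ/n')^* be the inverse of p mod n', and let χ = χ' ∘ π be the character of ℤ/n obtained via the canonical reduction π : (ℤ/n)^* → (ℤ/n')^*. Then e_n(χ) = (p^{-k} − χ'(q)) · e_{n'}(χ'). -/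
/-- The polylogarithm series: `Li k z = ∑_{m=1}^∞ z^m / m^k`. -/
noncomputable def Li (k : ℕ) (z : ℂ) : ℂ := ∑' m : ℕ, z ^ (m + 1) / ((m : ℂ) + 1) ^ k

/-- `e_n(χ) = ∑_{a ∈ (ℤ/n)^*} Li_{k+1}(ζ_n^a) · conj(χ(a))`. -/
noncomputable def eSum (n k : ℕ) [NeZero n] (χ : (ZMod n)ˣ →* ℂˣ) : ℂ :=
  ∑ a : (ZMod n)ˣ, Li (k + 1) (zetaN n ^ ((a : ZMod n).val)) *
    (starRingEnd ℂ) ((χ a : ℂˣ) : ℂ)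

lemma zetaN_isPrimitiveRoot (n : ℕ) [NeZero n] : IsPrimitiveRoot (zetaN n) n :=
  Complex.isPrimitiveRoot_exp n (NeZero.ne n)

lemma zetaN_mul_pow_left (p n : ℕ) (hp : p ≠ 0) : zetaN (p * n) ^ p = zetaN n := by
  have hp' : (p : ℂ) ≠ 0 := Nat.cast_ne_zero.mpr hp
  rw [zetaN, zetaN, ← Complex.exp_nat_mul]
  congr 1
  push_cast
  rw [mul_div_assoc', mul_div_mul_left _ _ hp']

lemma norm_zetaN (n : ℕ) [NeZero n] : ‖zetaN n‖ = 1 :=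
  (zetaN_isPrimitiveRoot n).norm'_eq_one (NeZero.ne n)

lemma summable_Li {s : ℕ} (hs : 1 < s) {z : ℂ} (hz : ‖z‖ ≤ 1) :
    Summable fun m : ℕ => z ^ (m + 1) / ((m : ℂ) + 1) ^ s := by
  have h := (summable_nat_add_iff 1).mpr (Real.summable_one_div_nat_pow.mpr hs)
  refine h.of_norm_bounded fun m => ?_
  have hm : ‖(m : ℂ) + 1‖ = (m : ℝ) + 1 := by
    exact_mod_cast Complex.norm_natCast (m + 1)
  rw [norm_div, norm_pow, norm_pow, hm, Nat.cast_add_one]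
  gcongr
  exact pow_le_one₀ (norm_nonneg z) hz

/-- Power sums over the translates of `w` by the `p`-th roots of unity. -/
lemma IsPrimitiveRoot.sum_mul_pow_pow {p : ℕ} (w : ℂ) {η : ℂ} (hη : IsPrimitiveRoot η p)
    (m : ℕ) :
    ∑ j ∈ Finset.range p, (w * η ^ j) ^ m = if p ∣ m then (p : ℂ) * w ^ m else 0 := by
  have hterm : ∀ j, (w * η ^ j) ^ m = w ^ m * (η ^ m) ^ j := fun j => by
    rw [mul_pow, ← pow_mul, ← pow_mul, mul_comm j]
  simp_rw [hterm, ← Finset.mul_sum]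
  split_ifs with h
  · simp [(hη.pow_eq_one_iff_dvd m).mpr h, mul_comm]
  · have hne : η ^ m ≠ 1 := fun h1 => h ((hη.pow_eq_one_iff_dvd m).mp h1)
    rw [geom_sum_eq hne, ← pow_mul, mul_comm m, pow_mul, hη.pow_eq_one]
    simp

/-- The distribution relation for polylogarithms. -/
lemma sum_Li_mul_pow {k p : ℕ} (hk : 1 ≤ k) (hp : 0 < p) {w η : ℂ} (hw : ‖w‖ ≤ 1)
    (hη : IsPrimitiveRoot η p) :
    ∑ j ∈ Finset.range p, Li (k + 1) (w * η ^ j) = ((p : ℂ) ^ k)⁻¹ * Li (k + 1) (w ^ p) := by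
  have hp' : (p : ℂ) ≠ 0 := Nat.cast_ne_zero.mpr hp.ne'
  have hnorm : ∀ j, ‖w * η ^ j‖ ≤ 1 := fun j => by
    simpa [hη.norm'_eq_one hp.ne'] using hw
  simp only [Li]
  rw [← Summable.tsum_finsetSum fun j _ => summable_Li (by omega) (hnorm j), ← tsum_mul_left]
  simp_rw [← Finset.sum_div, hη.sum_mul_pow_pow]
  have hidx : ∀ l : ℕ, p * (l + 1) - 1 + 1 = p * (l + 1) := fun l =>
    Nat.sub_add_cancel (Nat.mul_pos hp l.succ_pos)
  have hinj : Function.Injective fun l : ℕ => p * (l + 1) - 1 := fun a b hab => by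
    have h : p * (a + 1) = p * (b + 1) := by
      rw [← hidx a, ← hidx b]
      exact congrArg (· + 1) hab
    exact Nat.succ_injective (Nat.eq_of_mul_eq_mul_left hp h)
  rw [← hinj.tsum_eq]
  · refine tsum_congr fun l => ?_
    have hcast : ((p * (l + 1) - 1 : ℕ) : ℂ) + 1 = p * (l + 1) := by
      exact_mod_cast congrArg (Nat.cast (R := ℂ)) (hidx l)
    have hl : (l : ℂ) + 1 ≠ 0 := Nat.cast_add_one_ne_zero l
    simp only [hidx, hcast, dvd_mul_right, if_true]
    rw [← pow_mul]
    field_simp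
    rw [mul_pow, pow_succ (p : ℂ) k]
    ring
  · intro m hm
    have hdvd : p ∣ m + 1 := by
      by_contra h
      simp [h] at hm
    obtain ⟨c, hc⟩ := hdvd
    obtain _ | l := c
    · simp at hc
    · exact ⟨l, by simp only [← hc, Nat.add_sub_cancel]⟩

lemma eSum_eq_sum_range (n k : ℕ) [NeZero n] (χ : (ZMod n)ˣ →* ℂˣ) :
    eSum n k χ = ∑ a ∈ Finset.range n, Li (k + 1) (zetaN n ^ a) *
      (starRingEnd ℂ) (MulChar.ofUnitHom χ (a : ZMod n)) := by
  have hval : ∑ x : ZMod n, Li (k + 1) (zetaN n ^ x.val) *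
      (starRingEnd ℂ) (MulChar.ofUnitHom χ x) = ∑ a ∈ Finset.range n,
      Li (k + 1) (zetaN n ^ a) * (starRingEnd ℂ) (MulChar.ofUnitHom χ (a : ZMod n)) := by
    refine Finset.sum_bij (fun x _ => x.val) (fun x _ => Finset.mem_range.mpr x.val_lt)
      (fun x _ y _ h => ZMod.val_injective n h)
      (fun a ha => ⟨a, Finset.mem_univ _, ZMod.val_cast_of_lt (Finset.mem_range.mp ha)⟩)
      fun x _ => by rw [ZMod.natCast_zmod_val]
  rw [← hval, eSum]
  refine Finset.sum_of_injOn (fun u : (ZMod n)ˣ => (u : ZMod n)) Units.val_injective.injOn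
    (fun _ _ => Finset.mem_coe.mpr (Finset.mem_univ _)) (fun x _ hx => ?_)
    fun u _ => by rw [MulChar.ofUnitHom_coe]
  have hx' : ¬ IsUnit x := fun ⟨u, hu⟩ => hx ⟨u, Finset.mem_coe.mpr (Finset.mem_univ _), hu⟩
  rw [MulChar.map_nonunit _ hx', map_zero, mul_zero]

lemma ofUnitHom_comp_unitsMap_natCast {p n : ℕ} (hp : p.Prime) (χ : (ZMod n)ˣ →* ℂˣ) (a : ℕ) :
    MulChar.ofUnitHom (χ.comp (ZMod.unitsMap (dvd_mul_left n p))) (a : ZMod (p * n)) =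
      if p ∣ a then 0 else MulChar.ofUnitHom χ (a : ZMod n) := by
  split_ifs with h
  · refine MulChar.map_nonunit _ fun hu => ?_
    have := (ZMod.isUnit_iff_coprime a (p * n)).mp hu
    exact (hp.coprime_iff_not_dvd.mp this.coprime_mul_right_right.symm) h
  · by_cases hn : a.Coprime n
    · have hpn : a.Coprime (p * n) := (hp.coprime_iff_not_dvd.mpr h).symm.mul_right hn
      rw [← ZMod.coe_unitOfCoprime a hpn, ← ZMod.coe_unitOfCoprime a hn, MulChar.ofUnitHom_coe,
        MulChar.ofUnitHom_coe, MonoidHom.comp_apply]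
      congr 2
      ext
      simp [ZMod.unitsMap_val]
    · rw [MulChar.map_nonunit, MulChar.map_nonunit]
      · rwa [ZMod.isUnit_iff_coprime]
      · rw [ZMod.isUnit_iff_coprime]
        exact fun hpn => hn hpn.coprime_mul_left_right

lemma sum_range_mul_eq_sum_sum (p n : ℕ) (f : ℕ → ℂ) :
    ∑ a ∈ Finset.range (p * n), f a =
      ∑ b ∈ Finset.range n, ∑ j ∈ Finset.range p, f (b + n * j) := by
  rw [Finset.sum_comm]
  induction p with
  | zero => simp
  | succ p ih =>
    rw [Nat.succ_mul, Finset.sum_range_add, Finset.sum_range_succ, ih]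
    congr 1
    exact Finset.sum_congr rfl fun b _ => by rw [add_comm, mul_comm]

lemma sum_range_mul_ite_dvd {p : ℕ} (hp : 0 < p) (n : ℕ) (f : ℕ → ℂ) :
    ∑ a ∈ Finset.range (p * n), (if p ∣ a then f a else 0) =
      ∑ c ∈ Finset.range n, f (p * c) := by
  symm
  refine Finset.sum_of_injOn (fun c => p * c)
    (fun a _ b _ h => Nat.eq_of_mul_eq_mul_left hp h) (fun c hc => ?_) (fun a ha hna => ?_)
    fun c _ => by simp
  · simpa [hp] using hc
  · refine if_neg fun ⟨c, hc⟩ => hna ⟨c, ?_, hc.symm⟩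
    subst hc
    simpa [hp] using ha

/-- The values of a character of a finite group have inverse equal to their conjugate. -/
lemma conj_character_apply {G : Type*} [Group G] [Finite G] (χ : G →* ℂˣ) (g : G) :
    (starRingEnd ℂ) (χ g : ℂ) = (χ g⁻¹ : ℂ) := by
  have hpow : (χ g : ℂ) ^ Nat.card G = 1 := by
    rw [← Units.val_pow_eq_pow_val, ← map_pow, pow_card_eq_one', map_one, Units.val_one]
  have hnorm : ‖(χ g : ℂ)‖ = 1 := Complex.norm_eq_one_of_pow_eq_one hpow Nat.card_pos.ne'
  rw [← Complex.inv_eq_conj hnorm, map_inv, Units.val_inv_eq_inv_val]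

/-- Let `k ≥ 1`, `p` prime, `n' ≥ 1` with `p ∤ n'`, and `n = p·n'`. Let `χ'` be a
character of `ℤ/n'`, let `q ∈ (ℤ/n')^*` be the inverse of `p` mod `n'`, and let
`χ = χ' ∘ π` with `π : (ℤ/n)^* → (ℤ/n')^*` the canonical reduction. Then
`e_n(χ) = (p^{-k} − χ'(q)) · e_{n'}(χ')`. -/
theorem stmt10 (k p n' : ℕ) (hk : 1 ≤ k) (hp : p.Prime) [NeZero n'] (hpn' : ¬ p ∣ n')
    (χ' : (ZMod n')ˣ →* ℂˣ) :
    haveI : NeZero p := ⟨hp.ne_zero⟩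
    eSum (p * n') k (χ'.comp (ZMod.unitsMap (dvd_mul_left n' p))) =
      (((p : ℂ) ^ k)⁻¹ -
          ((χ' ((ZMod.unitOfCoprime p (hp.coprime_iff_not_dvd.mpr hpn'))⁻¹) : ℂˣ) : ℂ)) *
        eSum n' k χ' := by
  have : NeZero p := ⟨hp.ne_zero⟩
  set ψ : ℕ → ℂ := fun a => (starRingEnd ℂ) (MulChar.ofUnitHom χ' (a : ZMod n')) with hψ
  set F : ℕ → ℂ := fun a => Li (k + 1) (zetaN (p * n') ^ a) * ψ a with hF
  have hζp : zetaN (p * n') ^ p = zetaN n' := zetaN_mul_pow_left p n' hp.ne_zero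
  have hη : IsPrimitiveRoot (zetaN (p * n') ^ n') p :=
    (zetaN_isPrimitiveRoot (p * n')).pow (NeZero.pos _) (mul_comm p n')
  have hsplit : eSum (p * n') k (χ'.comp (ZMod.unitsMap (dvd_mul_left n' p))) =
      ∑ a ∈ Finset.range (p * n'), F a -
        ∑ a ∈ Finset.range (p * n'), (if p ∣ a then F a else 0) := by
    rw [eSum_eq_sum_range, ← Finset.sum_sub_distrib]
    refine Finset.sum_congr rfl fun a _ => ?_
    rw [ofUnitHom_comp_unitsMap_natCast hp]
    split_ifs <;> simp [hF, hψ]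
  have hfull : ∑ a ∈ Finset.range (p * n'), F a = ((p : ℂ) ^ k)⁻¹ * eSum n' k χ' := by
    rw [sum_range_mul_eq_sum_sum, eSum_eq_sum_range, Finset.mul_sum]
    refine Finset.sum_congr rfl fun b _ => ?_
    have hw : ‖zetaN (p * n') ^ b‖ ≤ 1 := by simp [norm_zetaN]
    rw [← mul_assoc, ← hζp, ← pow_mul, mul_comm p b, pow_mul,
      ← sum_Li_mul_pow hk hp.pos hw hη, Finset.sum_mul]
    refine Finset.sum_congr rfl fun j _ => ?_
    simp [hF, hψ, pow_add, pow_mul]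
  have hψp : ψ p =
      (χ' (ZMod.unitOfCoprime p (hp.coprime_iff_not_dvd.mpr hpn'))⁻¹ : ℂ) := by
    rw [← conj_character_apply, ← MulChar.ofUnitHom_coe, ZMod.coe_unitOfCoprime]
  have hdvd : ∑ a ∈ Finset.range (p * n'), (if p ∣ a then F a else 0) =
      ψ p * eSum n' k χ' := by
    rw [sum_range_mul_ite_dvd hp.pos, eSum_eq_sum_range, Finset.mul_sum]
    refine Finset.sum_congr rfl fun c _ => ?_
    simp only [hF, hψ, pow_mul, hζp, Nat.cast_mul, map_mul]
    ring
  rw [hsplit, hfull, hdvd, hψp, sub_mul]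
end
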